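/- arXiv:1503.01784 — 2 statements merged into one kernel-verified Lean document; each statement's English description precedes it below -/
import Mathlib

section
/- Let T* > 0, C > 0, and let y : [0,T*) → (0,∞) be continuous and satisfy y(t₂) ≤ y(t₁) + C ∫_{t₁}^{t₂} y(τ)² dτ for all 0 ≤ t₁ ≤ t₂ < T*. If limsup_{t→T*⁻} y(t) = ∞, then y(t) ≥ 1/(C(T* − t)) for every t ∈ [0,T*). -/
open MeasureTheory Filter
open scoped Topology

/-- If `y : [0,T*) → (0,∞)` is continuous, satisfies the Riccati-type integral
inequality `y(t₂) ≤ y(t₁) + C ∫_{t₁}^{t₂} y(τ)² dτ` for all `0 ≤ t₁ ≤ t₂ < T*`, and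
`limsup_{t→T*⁻} y(t) = ∞`, then `y(t) ≥ 1/(C (T* − t))` for every `t ∈ [0,T*)`. -/
theorem riccati_blowup_lower_bound (Tstar C : ℝ) (hT : 0 < Tstar) (hC : 0 < C)
    (y : ℝ → ℝ) (hy_pos : ∀ t ∈ Set.Ico (0 : ℝ) Tstar, 0 < y t)
    (hy_cont : ContinuousOn y (Set.Ico 0 Tstar))
    (hy_ineq : ∀ t₁ t₂ : ℝ, 0 ≤ t₁ → t₁ ≤ t₂ → t₂ < Tstar →
      y t₂ ≤ y t₁ + C * ∫ τ in Set.Icc t₁ t₂, y τ ^ 2)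
    (hy_blowup : ∀ M : ℝ, ∃ᶠ t in 𝓝[<] Tstar, M < y t) :
    ∀ t ∈ Set.Ico (0 : ℝ) Tstar, 1 / (C * (Tstar - t)) ≤ y t := by
  intro t0 ht0
  have h0 := hy_pos t0 ht0
  have key : ∀ b, t0 < b → b < Tstar → 1 / y t0 ≤ 1 / y b + C * (b - t0) := by
    intro b hb hbT
    set w : ℝ → ℝ := fun τ => y (max t0 (min b τ)) with hw
    have hmem : ∀ τ, max t0 (min b τ) ∈ Set.Ico 0 Tstar := fun τ =>
      ⟨le_trans ht0.1 (le_max_left _ _), max_lt ht0.2 (lt_of_le_of_lt (min_le_left _ _) hbT)⟩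
    have hwc : Continuous w := hy_cont.comp_continuous (by fun_prop) hmem
    have hwe : ∀ τ ∈ Set.Icc t0 b, w τ = y τ := by
      intro τ hτ
      simp only [hw]
      rw [min_eq_right hτ.2, max_eq_right hτ.1]
    set z : ℝ → ℝ := fun s => y t0 + C * ∫ τ in t0..s, w τ ^ 2 with hz
    have hzd : ∀ s, HasDerivAt z (C * w s ^ 2) s := by
      intro s
      have := (hwc.pow 2).integral_hasStrictDerivAt t0 s
      exact (this.hasDerivAt.const_mul C).const_add (y t0)
    have hle : ∀ s ∈ Set.Icc t0 b, y s ≤ z s := by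
      intro s hs
      have h := hy_ineq t0 s ht0.1 hs.1 (lt_of_le_of_lt hs.2 hbT)
      have e : ∫ τ in t0..s, w τ ^ 2 = ∫ τ in Set.Icc t0 s, y τ ^ 2 := by
        rw [intervalIntegral.integral_of_le hs.1, ← integral_Icc_eq_integral_Ioc]
        apply setIntegral_congr_fun measurableSet_Icc
        intro τ hτ
        simp only
        rw [hwe τ ⟨hτ.1, hτ.2.trans hs.2⟩]
      simp only [hz]
      rw [e]
      exact h
    have hyp : ∀ s ∈ Set.Icc t0 b, 0 < y s := fun s hs =>
      hy_pos s ⟨ht0.1.trans hs.1, lt_of_le_of_lt hs.2 hbT⟩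
    have hzp : ∀ s ∈ Set.Icc t0 b, 0 < z s := fun s hs => (hyp s hs).trans_le (hle s hs)
    have hgd : ∀ s ∈ Set.Icc t0 b, HasDerivAt (fun s => (z s)⁻¹ + C * s)
        (-(C * w s ^ 2) / z s ^ 2 + C * 1) s := fun s hs =>
      ((hzd s).inv (hzp s hs).ne').add ((hasDerivAt_id s).const_mul C)
    have hmono : MonotoneOn (fun s => (z s)⁻¹ + C * s) (Set.Icc t0 b) := by
      apply monotoneOn_of_deriv_nonneg (convex_Icc _ _)
      · exact fun s hs => (hgd s hs).continuousAt.continuousWithinAt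
      · exact fun s hs => (hgd s (interior_subset hs)).differentiableAt.differentiableWithinAt
      · intro s hs
        have hs' := interior_subset hs
        rw [(hgd s hs').deriv, hwe s hs']
        have h1 : C * y s ^ 2 / z s ^ 2 ≤ C := by
          rw [div_le_iff₀ (pow_pos (hzp s hs') 2)]
          have := hle s hs'
          have := (hyp s hs').le
          gcongr
        rw [neg_div]
        linarith
    have h := hmono (Set.left_mem_Icc.2 hb.le) (Set.right_mem_Icc.2 hb.le) hb.le
    have hz0 : z t0 = y t0 := by simp [hz]
    simp only [hz0] at h
    have hb' := Set.right_mem_Icc.2 hb.le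
    have h2 : (z b)⁻¹ ≤ (y b)⁻¹ := inv_anti₀ (hyp b hb') (hle b hb')
    rw [one_div, one_div]
    linarith
  have hd : 0 < Tstar - t0 := sub_pos.2 ht0.2
  have main : 1 / y t0 ≤ C * (Tstar - t0) := by
    apply le_of_forall_pos_le_add
    intro ε hε
    have hev : ∀ᶠ t in 𝓝[<] Tstar, t ∈ Set.Ioo t0 Tstar := Ioo_mem_nhdsLT ht0.2
    obtain ⟨b, hb1, hb2⟩ := ((hy_blowup (1 / ε)).and_eventually hev).exists
    have h := key b hb2.1 hb2.2
    have h3 : 1 / y b ≤ ε := by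
      rw [one_div]
      rw [one_div] at hb1
      exact inv_le_of_inv_le₀ hε hb1.le
    have h4 : C * (b - t0) ≤ C * (Tstar - t0) := by
      have := hb2.2.le
      gcongr
    linarith
  rw [one_div] at main ⊢
  exact inv_le_of_inv_le₀ h0 main
end

section
/- Let T* > 0, C > 0, γ > 1, and let y : [0,T*) → (0,∞) be continuous and satisfy y(t₂) ≤ y(t₁) + C ∫_{t₁}^{t₂} y(τ)^γ dτ for all 0 ≤ t₁ ≤ t₂ < T*. If limsup_{t→T*⁻} y(t) = ∞, then y(t) ≥ ( C(γ−1)(T* − t) )^{−1/(γ−1)} for every t ∈ [0,T*). -/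
open MeasureTheory Filter
open scoped Topology

/-- If `γ > 1` and `y : [0,T*) → (0,∞)` is continuous, satisfies the integral
inequality `y(t₂) ≤ y(t₁) + C ∫_{t₁}^{t₂} y(τ)^γ dτ` for all `0 ≤ t₁ ≤ t₂ < T*`, and
`limsup_{t→T*⁻} y(t) = ∞`, then `y(t) ≥ (C (γ−1) (T* − t))^{−1/(γ−1)}` for all `t ∈ [0,T*)`. -/
theorem riccati_power_blowup_lower_bound (Tstar C γ : ℝ) (hT : 0 < Tstar) (hC : 0 < C)
    (hγ : 1 < γ) (y : ℝ → ℝ) (hy_pos : ∀ t ∈ Set.Ico (0 : ℝ) Tstar, 0 < y t)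
    (hy_cont : ContinuousOn y (Set.Ico 0 Tstar))
    (hy_ineq : ∀ t₁ t₂ : ℝ, 0 ≤ t₁ → t₁ ≤ t₂ → t₂ < Tstar →
      y t₂ ≤ y t₁ + C * ∫ τ in Set.Icc t₁ t₂, y τ ^ γ)
    (hy_blowup : ∀ M : ℝ, ∃ᶠ t in 𝓝[<] Tstar, M < y t) :
    ∀ t ∈ Set.Ico (0 : ℝ) Tstar,
      (C * (γ - 1) * (Tstar - t)) ^ (-(1 / (γ - 1))) ≤ y t := by
  intro t ht
  have hg : 0 < γ - 1 := by linarith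
  have hyt := hy_pos t ht
  -- the integrated differential inequality
  have key : ∀ s, t < s → s < Tstar →
      y t ^ (1 - γ) ≤ y s ^ (1 - γ) + (γ - 1) * C * (s - t) := by
    intro s hts hsT
    have hmem : ∀ τ : ℝ, max t (min τ s) ∈ Set.Ico (0 : ℝ) Tstar := fun τ =>
      ⟨ht.1.trans (le_max_left _ _), max_lt ht.2 ((min_le_right _ _).trans_lt hsT)⟩
    set z : ℝ → ℝ := fun τ => y (max t (min τ s)) with hz
    have hzc : Continuous z :=
      hy_cont.comp_continuous (by fun_prop) hmem
    have hzpos : ∀ τ, 0 < z τ := fun τ => hy_pos _ (hmem τ)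
    have hzeq : ∀ τ ∈ Set.Icc t s, z τ = y τ := by
      intro τ hτ
      simp only [hz]
      rw [min_eq_left hτ.2, max_eq_right hτ.1]
    have hfc : Continuous (fun τ => z τ ^ γ) :=
      hzc.rpow_const (fun τ => Or.inl (hzpos τ).ne')
    set Φ : ℝ → ℝ := fun u => y t + C * ∫ τ in t..u, z τ ^ γ with hΦ
    have hΦd : ∀ u, HasDerivAt Φ (C * z u ^ γ) u := fun u =>
      ((hfc.integral_hasStrictDerivAt t u).hasDerivAt.const_mul C).const_add (y t)
    have hΦge : ∀ u ∈ Set.Icc t s, y u ≤ Φ u := by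
      intro u hu
      have h := hy_ineq t u ht.1 hu.1 (hu.2.trans_lt hsT)
      have he : ∫ τ in Set.Icc t u, y τ ^ γ = ∫ τ in t..u, z τ ^ γ := by
        rw [intervalIntegral.integral_of_le hu.1, ← integral_Icc_eq_integral_Ioc]
        refine setIntegral_congr_fun measurableSet_Icc (fun τ hτ => ?_)
        simp only [hzeq τ ⟨hτ.1, hτ.2.trans hu.2⟩]
      rw [he] at h
      exact h
    have hΦpos : ∀ u ∈ Set.Icc t s, 0 < Φ u := fun u hu =>
      (hzpos u).trans_le ((hzeq u hu).le.trans (hΦge u hu))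
    have hGd : ∀ u ∈ Set.Icc t s, HasDerivAt (fun u => Φ u ^ (1 - γ) + (γ - 1) * C * u)
        ((C * z u ^ γ) * (1 - γ) * Φ u ^ (1 - γ - 1) + (γ - 1) * C * 1) u := fun u hu =>
      ((hΦd u).rpow_const (Or.inl (hΦpos u hu).ne')).add ((hasDerivAt_id u).const_mul _)
    have hmono : MonotoneOn (fun u => Φ u ^ (1 - γ) + (γ - 1) * C * u) (Set.Icc t s) := by
      refine monotoneOn_of_deriv_nonneg (convex_Icc t s)
        (fun u hu => (hGd u hu).continuousAt.continuousWithinAt)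
        (fun u hu => (hGd u (interior_subset hu)).differentiableAt.differentiableWithinAt) ?_
      intro u hu
      have hu := interior_subset hu
      rw [(hGd u hu).deriv]
      have h1 : z u ^ γ ≤ Φ u ^ γ :=
        Real.rpow_le_rpow (hzpos u).le ((hzeq u hu).le.trans (hΦge u hu)) (by linarith)
      have h2 : z u ^ γ * Φ u ^ (1 - γ - 1) ≤ 1 := by
        have h3 : Φ u ^ γ * Φ u ^ (1 - γ - 1) = 1 := by
          rw [← Real.rpow_add (hΦpos u hu)]
          simp
        exact (mul_le_mul_of_nonneg_right h1 (Real.rpow_nonneg (hΦpos u hu).le _)).trans h3.le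
      have h4 := mul_nonneg (mul_pos hg hC).le (sub_nonneg.2 h2)
      linarith
    have h := hmono (Set.left_mem_Icc.2 hts.le) (Set.right_mem_Icc.2 hts.le) hts.le
    have hΦt : Φ t = y t := by simp [hΦ]
    simp only [hΦt] at h
    have h5 : Φ s ^ (1 - γ) ≤ y s ^ (1 - γ) :=
      Real.rpow_le_rpow_of_nonpos (hy_pos s ⟨ht.1.trans hts.le, hsT⟩)
        (hΦge s (Set.right_mem_Icc.2 hts.le)) (by linarith)
    linarith
  have key2 : ∀ M : ℝ, 0 < M → y t ^ (1 - γ) ≤ M ^ (-(γ - 1)) + C * (γ - 1) * (Tstar - t) := by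
    intro M hM
    obtain ⟨s, hs, hs'⟩ := ((hy_blowup M).and_eventually (Ioo_mem_nhdsLT ht.2)).exists
    have h1 := key s hs'.1 hs'.2
    have h2 : y s ^ (1 - γ) ≤ M ^ (-(γ - 1)) := by
      rw [neg_sub]
      exact Real.rpow_le_rpow_of_nonpos hM hs.le (by linarith)
    have h3 := mul_le_mul_of_nonneg_left hs'.2.le (mul_pos hg hC).le
    linarith
  have key3 : y t ^ (1 - γ) ≤ C * (γ - 1) * (Tstar - t) := by
    have hl := (tendsto_rpow_neg_atTop hg).add_const (C * (γ - 1) * (Tstar - t))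
    rw [zero_add] at hl
    exact ge_of_tendsto hl ((eventually_gt_atTop 0).mono key2)
  calc _ ≤ (y t ^ (1 - γ)) ^ (-(1 / (γ - 1))) :=
        Real.rpow_le_rpow_of_nonpos (Real.rpow_pos_of_pos hyt _) key3
          (neg_nonpos.2 (by positivity))
    _ = y t := by
        rw [← Real.rpow_mul hyt.le]
        have : (1 - γ) * -(1 / (γ - 1)) = 1 := by
          field_simp
          ring
        rw [this, Real.rpow_one]
end
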